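/- For every y = (y₁,y₂,y₃,y₄) ∈ ℝ⁴ with all coordinates positive, all denominators occurring in the entries of M₃(y) are nonzero, all 20 maximal minors p_I(M₃(y)) are nonzero, and their signs realize the chirotope χ of rank 3 on 6 elements with χ({4,5,6}) = −1 and χ(I) = +1 for every other 3-subset I of [6]; that is, p_{{4,5,6}}(M₃(y)) < 0 and p_I(M₃(y)) > 0 for all I ≠ {4,5,6}. -/

import Mathlib

open scoped BigOperators

/-- The `3 × 3` minor of a `3 × 6` matrix on columns `i, j, k`, taken in this order. -/
noncomputable def minor3 (A : Matrix (Fin 3) (Fin 6) ℝ) (i j k : Fin 6) : ℝ :=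
  Matrix.det (Matrix.of fun r c => A r (![i, j, k] c))

/-- The parameterizing matrix `M₃(y)` of the type-3 chirotope of rank 3 on 6 elements
(`y i` stands for `y_{i+1}`). -/
noncomputable def M3 (y : Fin 4 → ℝ) : Matrix (Fin 3) (Fin 6) ℝ :=
  !![1, 0, 0, 1, (y 0 + 1) / y 0, (y 0 * y 2 + y 2 + 1) / (y 0 * y 2);
     0, 1, 0, -1,
       -((y 0 + 1) * (y 1 * y 3 + y 3 + 1)) /
         (y 0 * y 1 * y 3 + y 0 * y 3 + y 0 + y 3 + 1),
       -((y 0 * y 1 * y 2 + y 1 * y 2 + y 1 + y 0 * y 2 + y 2) * (y 1 * y 3 + y 3 + 1)) /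
         ((y 1 + 1) * y 2 * (y 0 * y 1 * y 3 + y 0 * y 3 + y 0 + y 3 + 1));
     0, 0, 1, 1, 1, 1]

theorem minor3_formula (A : Matrix (Fin 3) (Fin 6) ℝ) (i j k : Fin 6) :
    minor3 A i j k = A 0 i * A 1 j * A 2 k - A 0 i * A 1 k * A 2 j - A 0 j * A 1 i * A 2 k
      + A 0 j * A 1 k * A 2 i + A 0 k * A 1 i * A 2 j - A 0 k * A 1 j * A 2 i := by
  simp [minor3, Matrix.det_fin_three]

theorem signs_aux (a b c d : ℝ) (hb : 1 < b) (hd : b < d) (ha : 1 < a) (hc : a < c)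
    (hab : b < a) (hcd : d < c) (h1 : a * d < b * c)
    (h2 : (d - b) * (1 - a) + (c - a) * (b - 1) < 0) (i j k : Fin 6) (hij : i < j) (hjk : j < k) :
    if ({i, j, k} : Finset (Fin 6)) = {3, 4, 5} then
      minor3 !![1, 0, 0, 1, a, c; 0, 1, 0, -1, -b, -d; 0, 0, 1, 1, 1, 1] i j k < 0
      else 0 < minor3 !![1, 0, 0, 1, a, c; 0, 1, 0, -1, -b, -d; 0, 0, 1, 1, 1, 1] i j k := by
  have key : ∀ i j k : Fin 6, i < j → j < k →
      ((({i, j, k} : Finset (Fin 6)) = {3, 4, 5}) ↔ (i = 3 ∧ j = 4 ∧ k = 5)) := by decide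
  rw [minor3_formula]
  simp only [key i j k hij hjk]
  fin_cases i <;> fin_cases j <;> first
    | exact absurd hij (by decide)
    | (fin_cases k <;> first
        | exact absurd hjk (by decide)
        | (simp; done)
        | (simp; linarith)
        | (simp; nlinarith))

/-- For `y` in the positive orthant, all denominators occurring in the entries of `M₃(y)` are
nonzero, and the 20 maximal minors of `M₃(y)` are nonzero with sign pattern realizing the
chirotope with `χ {4,5,6} = -1` (0-indexed: columns `3,4,5`) and `χ I = +1` otherwise. -/
theorem M3_minor_signs (y : Fin 4 → ℝ) (hy : ∀ i, 0 < y i) :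
    (y 0 ≠ 0 ∧ y 0 * y 2 ≠ 0 ∧
      y 0 * y 1 * y 3 + y 0 * y 3 + y 0 + y 3 + 1 ≠ 0 ∧
      (y 1 + 1) * y 2 * (y 0 * y 1 * y 3 + y 0 * y 3 + y 0 + y 3 + 1) ≠ 0) ∧
    (∀ i j k : Fin 6, i < j → j < k →
      if ({i, j, k} : Finset (Fin 6)) = {3, 4, 5} then minor3 (M3 y) i j k < 0
      else 0 < minor3 (M3 y) i j k) := by
  have hx := hy 0
  have hyy := hy 1
  have hz := hy 2
  have hw := hy 3
  unfold M3
  generalize y 0 = x at *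
  generalize y 1 = u at *
  generalize y 2 = z at *
  generalize y 3 = w at *
  have hD : 0 < x * u * w + x * w + x + w + 1 := by positivity
  refine ⟨⟨by positivity, by positivity, by positivity, by positivity⟩, ?_⟩
  intro i j k hij hjk
  rw [neg_div, neg_div]
  have e1 : (x + 1) / x = 1 + 1 / x := by field_simp
  have e2 : (x * z + z + 1) / (x * z) = (x + 1) / x + 1 / (x * z) := by field_simp
  have e3 : (x + 1) * (u * w + w + 1) / (x * u * w + x * w + x + w + 1)
      = 1 + u * w / (x * u * w + x * w + x + w + 1) := by field_simp; ring
  have e4 : (x * u * z + u * z + u + x * z + z) * (u * w + w + 1) /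
        ((u + 1) * z * (x * u * w + x * w + x + w + 1))
      = (x + 1) * (u * w + w + 1) / (x * u * w + x * w + x + w + 1)
        + u * (u * w + w + 1) / ((u + 1) * z * (x * u * w + x * w + x + w + 1)) := by
    field_simp; ring
  have p1 : 0 < 1 / x := by positivity
  have p2 : 0 < 1 / (x * z) := by positivity
  have p3 : 0 < u * w / (x * u * w + x * w + x + w + 1) := by positivity
  have p4 : 0 < u * (u * w + w + 1) / ((u + 1) * z * (x * u * w + x * w + x + w + 1)) := by
    positivity
  have hab : 1 / x - u * w / (x * u * w + x * w + x + w + 1)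
      = (x + 1) * (w + 1) / (x * (x * u * w + x * w + x + w + 1)) := by
    field_simp; ring
  have hab' : 0 < (x + 1) * (w + 1) / (x * (x * u * w + x * w + x + w + 1)) := by positivity
  have hcd : 1 / (x * z) - u * (u * w + w + 1) / ((u + 1) * z * (x * u * w + x * w + x + w + 1))
      = (x * (u * w + w + 1) + (u + 1) * (w + 1)) /
        ((u + 1) * x * z * (x * u * w + x * w + x + w + 1)) := by
    field_simp; ring
  have hcd' : 0 < (x * (u * w + w + 1) + (u + 1) * (w + 1)) /
        ((u + 1) * x * z * (x * u * w + x * w + x + w + 1)) := by positivity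
  apply signs_aux _ _ _ _ _ _ _ _ _ _ _ _ i j k hij hjk
  · linarith
  · linarith
  · linarith
  · linarith
  · linarith
  · linarith
  · rw [← sub_pos]
    have : 0 < (x + 1) * (u * w + w + 1) /
        (x * z * (x * u * w + x * w + x + w + 1) * (u + 1)) := by positivity
    convert this using 1
    field_simp; ring
  · rw [e4, e2, add_sub_cancel_left, add_sub_cancel_left, e3, e1, add_sub_cancel_left,
      ← neg_pos]
    have : 0 < u / (x * z * (x * u * w + x * w + x + w + 1) * (u + 1)) := by positivity
    convert this using 1
    field_simp; ring
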